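/- arXiv:1308.0251 — 8 statements merged into one kernel-verified Lean document; each statement's English description precedes it below -/
import Mathlib

section
/- Let A be a category with equalisers and coequalisers, and let F : A → A be an endofunctor admitting both a left adjoint and a right adjoint. Then the following are equivalent: (a) F is conservative (reflects isomorphisms); (b) F is monadic; (c) F is comonadic. If moreover F carries a monad structure F=(F,m,e), these are also equivalent to: (d) the free functor φ_F : A → A_F into the Eilenberg–Moore category of F-modules is comonadic. -/
/-!
STATEMENT 1: For a category `A` with equalisers and coequalisers and an endofunctor
`F : A ⥤ A` admitting both a left and a right adjoint, the following are equivalent: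
(a) `F` is conservative; (b) `F` is monadic; (c) `F` is comonadic.
If moreover `F` carries a monad structure `(F, m, e)`, these are also equivalent to:
(d) the free functor `φ_F : A ⥤ A_F` is comonadic.
-/

open CategoryTheory CategoryTheory.Limits

universe v

/-- A right adjoint that preserves colimits of parallel pairs, from a category with coequalizers,
is monadic as soon as it is conservative. -/
theorem reflectsIsomorphisms_iff_nonempty_monadicRightAdjoint
    {A B : Type*} [Category.{v} A] [Category.{v} B] [HasCoequalizers A]
    (R : A ⥤ B) [R.IsRightAdjoint] [PreservesColimitsOfShape WalkingParallelPair R] :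
    R.ReflectsIsomorphisms ↔ Nonempty (MonadicRightAdjoint R) := by
  refine ⟨fun _ => ?_, fun ⟨_⟩ => ?_⟩
  · have : Monad.HasCoequalizerOfIsSplitPair R := ⟨fun _ _ _ => inferInstance⟩
    have : Monad.PreservesColimitOfIsSplitPair R := ⟨fun _ _ _ => inferInstance⟩
    exact ⟨Monad.monadicOfHasPreservesGSplitCoequalizersOfReflectsIsomorphisms
      (Adjunction.ofIsRightAdjoint R)⟩
  · exact reflectsIsomorphisms_of_iso (Monad.comparisonForget (monadicAdjunction R))

/-- A left adjoint that preserves limits of parallel pairs, from a category with equalizers,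
is comonadic as soon as it is conservative. -/
theorem reflectsIsomorphisms_iff_nonempty_comonadicLeftAdjoint
    {A B : Type*} [Category.{v} A] [Category.{v} B] [HasEqualizers A]
    (L : A ⥤ B) [L.IsLeftAdjoint] [PreservesLimitsOfShape WalkingParallelPair L] :
    L.ReflectsIsomorphisms ↔ Nonempty (ComonadicLeftAdjoint L) := by
  refine ⟨fun _ => ?_, fun ⟨_⟩ => ?_⟩
  · have : Comonad.HasEqualizerOfIsCosplitPair L := ⟨fun _ _ _ => inferInstance⟩
    have : Comonad.PreservesLimitOfIsCosplitPair L := ⟨fun _ _ _ => inferInstance⟩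
    exact ⟨Comonad.comonadicOfHasPreservesFSplitEqualizersOfReflectsIsomorphisms
      (Adjunction.ofIsLeftAdjoint L)⟩
  · exact reflectsIsomorphisms_of_iso (Comonad.comparisonForget (comonadicAdjunction L))

/-- The free functor of a monad is conservative if and only if the underlying endofunctor is. -/
theorem CategoryTheory.Monad.free_reflectsIsomorphisms_iff
    {A : Type*} [Category A] (T : Monad A) :
    T.free.ReflectsIsomorphisms ↔ T.toFunctor.ReflectsIsomorphisms := by
  refine ⟨fun _ => inferInstanceAs (T.free ⋙ T.forget).ReflectsIsomorphisms, fun h => ⟨?_⟩⟩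
  intro X Y f _
  have : IsIso (T.map f) := inferInstanceAs (IsIso (T.forget.map (T.free.map f)))
  exact h.reflects f

/-- The free functor of a monad preserves the limits that the underlying endofunctor preserves. -/
theorem CategoryTheory.Monad.free_preservesLimitsOfShape
    {A J : Type*} [Category A] [Category J] (T : Monad A)
    [h : PreservesLimitsOfShape J T.toFunctor] : PreservesLimitsOfShape J T.free := by
  have : PreservesLimitsOfShape J (T.free ⋙ T.forget) := h
  exact preservesLimitsOfShape_of_reflects_of_preserves T.free T.forget

theorem conservative_iff_monadic_iff_comonadic
    {A : Type*} [Category A] [HasEqualizers A] [HasCoequalizers A]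
    (F : A ⥤ A) [F.IsRightAdjoint] [F.IsLeftAdjoint] :
    (F.ReflectsIsomorphisms ↔ Nonempty (MonadicRightAdjoint F)) ∧
    (F.ReflectsIsomorphisms ↔ Nonempty (ComonadicLeftAdjoint F)) ∧
    (∀ T : Monad A, T.toFunctor = F →
      (F.ReflectsIsomorphisms ↔ Nonempty (ComonadicLeftAdjoint T.free))) := by
  refine ⟨reflectsIsomorphisms_iff_nonempty_monadicRightAdjoint F,
    reflectsIsomorphisms_iff_nonempty_comonadicLeftAdjoint F, ?_⟩
  rintro T rfl
  have : T.free.IsLeftAdjoint := T.adj.isLeftAdjoint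
  have : PreservesLimitsOfShape WalkingParallelPair T.free := T.free_preservesLimitsOfShape
  exact T.free_reflectsIsomorphisms_iff.symm.trans
    (reflectsIsomorphisms_iff_nonempty_comonadicLeftAdjoint T.free)
end

section
/- Let T=(T,m,e) be a monad on a category A, let η,ε : F ⊣ R : B → A be an adjunction, and let α : T∘R → R be a left T-module structure on R (that is, α∘(eR) = id and α∘(mR) = α∘(Tα)). Let R̄ : B → A_T be the induced functor into the Eilenberg–Moore category of T-modules, sending B to (R(B), α_B), and let t : T → R∘F be the composite (αF)∘(Tη). Then R̄ is an equivalence of categories if and only if R is monadic and t is an isomorphism of functors. -/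
/-!
STATEMENT 2: Let `T` be a monad on `A`, `F ⊣ R : B ⥤ A` an adjunction, and
`α : T∘R ⟶ R` a left `T`-module structure on `R`. Let `R̄ : B ⥤ A_T` be the induced
functor `B ↦ (R(B), α_B)` and `t : T ⟶ R∘F` the composite `(αF) ∘ (Tη)`.
Then `R̄` is an equivalence iff `R` is monadic and `t` is an isomorphism of functors.
-/

open CategoryTheory

variable {A B : Type*} [Category A] [Category B]

/-- The functor `B ⥤ A_T` induced by a left `T`-module structure `α` on `R`. -/
@[simps] def moduleComparison (T : Monad A) (R : B ⥤ A) (α : R ⋙ T.toFunctor ⟶ R)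
    (hα₁ : ∀ X : B, T.η.app (R.obj X) ≫ α.app X = 𝟙 (R.obj X))
    (hα₂ : ∀ X : B, T.μ.app (R.obj X) ≫ α.app X = T.toFunctor.map (α.app X) ≫ α.app X) :
    B ⥤ T.Algebra where
  obj X :=
    { A := R.obj X
      a := α.app X
      unit := hα₁ X
      assoc := hα₂ X }
  map {X Y} f :=
    { f := R.map f
      h := α.naturality f }
  map_id X := by ext; simp
  map_comp f g := by ext; simp

/-- The monad morphism `t : T ⟶ R∘F` associated to the module structure `α`
and an adjunction `F ⊣ R`. -/
@[simps] def moduleCanonicalMorphism (T : Monad A) (R : B ⥤ A) {F : A ⥤ B} (adj : F ⊣ R)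
    (α : R ⋙ T.toFunctor ⟶ R) : T.toFunctor ⟶ F ⋙ R where
  app X := T.toFunctor.map (adj.unit.app X) ≫ α.app (F.obj X)
  naturality X Y f := by
    dsimp
    have h1 : f ≫ adj.unit.app Y = adj.unit.app X ≫ R.map (F.map f) := by simp
    have h2 := α.naturality (F.map f)
    dsimp at h2
    rw [← Functor.map_comp_assoc, h1, Functor.map_comp_assoc, h2]
    simp

/-- Morphisms out of a free algebra are determined by their restriction to the generators. -/
theorem free_hom_ext (T : Monad A) {X : A} {Y : T.Algebra} (f g : T.free.obj X ⟶ Y)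
    (h : T.η.app X ≫ f.f = T.η.app X ≫ g.f) : f = g := by
  apply (T.adj.homEquiv _ _).injective
  simpa [Adjunction.homEquiv_unit] using! h

section

variable (T : Monad A) (R : B ⥤ A) {F : A ⥤ B} (adj : F ⊣ R) (α : R ⋙ T.toFunctor ⟶ R)

theorem unit_comp_moduleCanonicalMorphism
    (hα₁ : ∀ X : B, T.η.app (R.obj X) ≫ α.app X = 𝟙 (R.obj X)) (X : A) :
    T.η.app X ≫ T.map (adj.unit.app X) ≫ α.app (F.obj X) = adj.unit.app X := by
  have h := T.η.naturality (adj.unit.app X)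
  dsimp at h
  rw [← reassoc_of% h, hα₁]
  exact Category.comp_id _

theorem mul_comp_moduleCanonicalMorphism
    (hα₂ : ∀ X : B, T.μ.app (R.obj X) ≫ α.app X = T.toFunctor.map (α.app X) ≫ α.app X) (X : A) :
    T.μ.app X ≫ T.map (adj.unit.app X) ≫ α.app (F.obj X) =
      T.map (T.map (adj.unit.app X) ≫ α.app (F.obj X)) ≫ α.app (F.obj X) := by
  have h := T.μ.naturality (adj.unit.app X)
  dsimp at h
  rw [← reassoc_of% h, hα₂, T.map_comp, Category.assoc]

theorem moduleCanonicalMorphism_comp_counit (X : B) :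
    (T.map (adj.unit.app (R.obj X)) ≫ α.app (F.obj (R.obj X))) ≫ R.map (adj.counit.app X) =
      α.app X := by
  have h₁ := α.naturality (adj.counit.app X)
  have h₂ := adj.right_triangle_components X
  dsimp at h₁ h₂
  rw [Category.assoc, ← h₁, ← T.map_comp_assoc, h₂]
  exact (congrArg (· ≫ α.app X) (T.map_id (R.obj X))).trans (Category.id_comp _)

/-- The canonical morphism `t : T ⟶ R∘F`, as a morphism of monads. -/
def moduleCanonicalMonadHom
    (hα₁ : ∀ X : B, T.η.app (R.obj X) ≫ α.app X = 𝟙 (R.obj X))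
    (hα₂ : ∀ X : B, T.μ.app (R.obj X) ≫ α.app X = T.toFunctor.map (α.app X) ≫ α.app X) :
    T ⟶ adj.toMonad where
  toNatTrans := moduleCanonicalMorphism T R adj α
  app_η X := unit_comp_moduleCanonicalMorphism T R adj α hα₁ X
  app_μ X := by
    change T.μ.app X ≫ T.map (adj.unit.app X) ≫ α.app (F.obj X) =
      (T.map (T.map (adj.unit.app X) ≫ α.app (F.obj X)) ≫
        T.map (adj.unit.app (R.obj (F.obj X))) ≫ α.app (F.obj (R.obj (F.obj X)))) ≫
        R.map (adj.counit.app (F.obj X))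
    rw [mul_comp_moduleCanonicalMorphism T R adj α hα₂, Category.assoc,
      moduleCanonicalMorphism_comp_counit]

/-- The functor induced by `α` factors through the comparison functor of the adjunction. -/
def moduleComparisonIso
    (hα₁ : ∀ X : B, T.η.app (R.obj X) ≫ α.app X = 𝟙 (R.obj X))
    (hα₂ : ∀ X : B, T.μ.app (R.obj X) ≫ α.app X = T.toFunctor.map (α.app X) ≫ α.app X) :
    Monad.comparison adj ⋙
        Monad.algebraFunctorOfMonadHom (moduleCanonicalMonadHom T R adj α hα₁ hα₂) ≅
      moduleComparison T R α hα₁ hα₂ :=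
  NatIso.ofComponents
    (fun X => Monad.Algebra.isoMk (Iso.refl (R.obj X)) (by
      change T.map (𝟙 (R.obj X)) ≫ α.app X = ((T.map (adj.unit.app (R.obj X)) ≫
        α.app (F.obj (R.obj X))) ≫ R.map (adj.counit.app X)) ≫ 𝟙 (R.obj X)
      rw [moduleCanonicalMorphism_comp_counit]
      exact (congrArg (· ≫ α.app X) (T.map_id (R.obj X))).trans
        ((Category.id_comp _).trans (Category.comp_id _).symm)))
    (fun f => by
      ext
      exact (Category.comp_id _).trans (Category.id_comp _).symm)

theorem isIso_moduleCanonicalMorphism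
    (hα₁ : ∀ X : B, T.η.app (R.obj X) ≫ α.app X = 𝟙 (R.obj X))
    (hα₂ : ∀ X : B, T.μ.app (R.obj X) ≫ α.app X = T.toFunctor.map (α.app X) ≫ α.app X)
    [(moduleComparison T R α hα₁ hα₂).Full] [(moduleComparison T R α hα₁ hα₂).EssSurj] :
    IsIso (moduleCanonicalMorphism T R adj α) := by
  let G := moduleComparison T R α hα₁ hα₂
  suffices ∀ X, IsIso ((moduleCanonicalMorphism T R adj α).app X) from
    NatIso.isIso_of_isIso_app _
  intro X
  let t : T.free.obj X ⟶ G.obj (F.obj X) :=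
    { f := T.map (adj.unit.app X) ≫ α.app (F.obj X)
      h := (mul_comp_moduleCanonicalMorphism T R adj α hα₂ X).symm }
  let i : G.obj (G.objPreimage (T.free.obj X)) ≅ T.free.obj X := G.objObjPreimageIso _
  let p : R.obj (G.objPreimage (T.free.obj X)) ⟶ T.obj X := i.hom.f
  let q : T.obj X ⟶ R.obj (G.objPreimage (T.free.obj X)) := i.inv.f
  have hqp : q ≫ p = 𝟙 _ := congrArg Monad.Algebra.Hom.f i.inv_hom_id
  let g : F.obj X ⟶ G.objPreimage (T.free.obj X) := (adj.homEquiv _ _).symm (T.η.app X ≫ q)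
  have hg : adj.unit.app X ≫ R.map g = T.η.app X ≫ q :=
    (adj.homEquiv_unit _ _ _).symm.trans (Equiv.apply_symm_apply _ _)
  let s : G.obj (F.obj X) ⟶ T.free.obj X := G.map g ≫ i.hom
  let t' : T.obj X ⟶ R.obj (F.obj X) := t.f
  let s' : R.obj (F.obj X) ⟶ T.obj X := s.f
  have ht : T.η.app X ≫ t' = adj.unit.app X :=
    unit_comp_moduleCanonicalMorphism T R adj α hα₁ X
  have hs : adj.unit.app X ≫ s' = T.η.app X := by
    change adj.unit.app X ≫ R.map g ≫ p = _
    rw [reassoc_of% hg, hqp]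
    exact Category.comp_id _
  have hts : t' ≫ s' = 𝟙 _ := by
    refine congrArg Monad.Algebra.Hom.f (free_hom_ext T (t ≫ s) (𝟙 _) ?_)
    change T.η.app X ≫ t' ≫ s' = T.η.app X ≫ 𝟙 _
    rw [reassoc_of% ht, hs, Category.comp_id]
  have hst : s' ≫ t' = 𝟙 _ := by
    obtain ⟨k, hk⟩ := G.map_surjective (s ≫ t)
    have hk' : R.map k = s' ≫ t' := congrArg Monad.Algebra.Hom.f hk
    have : k = 𝟙 _ := by
      apply (adj.homEquiv _ _).injective
      rw [adj.homEquiv_unit, adj.homEquiv_unit]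
      change adj.unit.app X ≫ R.map k = adj.unit.app X ≫ R.map (𝟙 (F.obj X))
      rw [hk', reassoc_of% hs, ht, R.map_id]
      exact (Category.comp_id _).symm
    rw [← hk', this, R.map_id]
  exact ⟨s', hts, hst⟩

theorem moduleComparison_isEquivalence_iff_comparison
    (hα₁ : ∀ X : B, T.η.app (R.obj X) ≫ α.app X = 𝟙 (R.obj X))
    (hα₂ : ∀ X : B, T.μ.app (R.obj X) ≫ α.app X = T.toFunctor.map (α.app X) ≫ α.app X)
    [IsIso (moduleCanonicalMorphism T R adj α)] :
    (moduleComparison T R α hα₁ hα₂).IsEquivalence ↔ (Monad.comparison adj).IsEquivalence := by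
  let t := moduleCanonicalMonadHom T R adj α hα₁ hα₂
  have : IsIso ((monadToFunctor A).map t) :=
    inferInstanceAs (IsIso (moduleCanonicalMorphism T R adj α))
  have : IsIso t := isIso_of_reflects_iso t (monadToFunctor A)
  have : (Monad.algebraFunctorOfMonadHom t).IsEquivalence :=
    (Monad.algebraEquivOfIsoMonads (asIso t).symm).isEquivalence_functor
  have φ := moduleComparisonIso T R adj α hα₁ hα₂
  constructor
  · intro h
    have := Functor.isEquivalence_of_iso φ.symm
    exact Functor.isEquivalence_of_comp_right _ (Monad.algebraFunctorOfMonadHom t)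
  · intro h
    exact Functor.isEquivalence_of_iso φ

end

/-- Whether the comparison functor is an equivalence does not depend on the left adjoint. -/
theorem comparison_isEquivalence_of_monadic (R : B ⥤ A) [MonadicRightAdjoint R]
    {F : A ⥤ B} (adj : F ⊣ R) : (Monad.comparison adj).IsEquivalence := by
  let adj' := monadicAdjunction R
  let α : R ⋙ adj'.toMonad.toFunctor ⟶ R := Functor.whiskerRight adj'.counit R
  have hα₁ (X : B) : adj'.toMonad.η.app (R.obj X) ≫ α.app X = 𝟙 (R.obj X) :=
    ((Monad.comparison adj').obj X).unit
  have hα₂ (X : B) : adj'.toMonad.μ.app (R.obj X) ≫ α.app X =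
      adj'.toMonad.toFunctor.map (α.app X) ≫ α.app X :=
    ((Monad.comparison adj').obj X).assoc
  have : (moduleComparison adj'.toMonad R α hα₁ hα₂).IsEquivalence :=
    inferInstanceAs (Monad.comparison (monadicAdjunction R)).IsEquivalence
  have := isIso_moduleCanonicalMorphism adj'.toMonad R adj α hα₁ hα₂
  exact (moduleComparison_isEquivalence_iff_comparison _ R adj α hα₁ hα₂).1 ‹_›

theorem moduleComparison_isEquivalence_iff_monadic_and_galois
    (T : Monad A) (R : B ⥤ A) {F : A ⥤ B} (adj : F ⊣ R)
    (α : R ⋙ T.toFunctor ⟶ R)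
    (hα₁ : ∀ X : B, T.η.app (R.obj X) ≫ α.app X = 𝟙 (R.obj X))
    (hα₂ : ∀ X : B, T.μ.app (R.obj X) ≫ α.app X = T.toFunctor.map (α.app X) ≫ α.app X) :
    (moduleComparison T R α hα₁ hα₂).IsEquivalence ↔
      (Nonempty (MonadicRightAdjoint R) ∧ IsIso (moduleCanonicalMorphism T R adj α)) := by
  constructor
  · intro h
    have := isIso_moduleCanonicalMorphism T R adj α hα₁ hα₂
    exact ⟨⟨⟨F, adj, (moduleComparison_isEquivalence_iff_comparison T R adj α hα₁ hα₂).1 h⟩⟩, this⟩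
  · rintro ⟨⟨_⟩, _⟩
    exact (moduleComparison_isEquivalence_iff_comparison T R adj α hα₁ hα₂).2
      (comparison_isEquivalence_of_monadic R adj)
end

section
/- Let G=(G,δ,ε) be a comonad on a category A, let L : B → A be a functor with a left G-comodule structure α : L → G∘L (that is, (εL)∘α = id and (δL)∘α = (Gα)∘α), and suppose L has a right adjoint S : A → B with counit σ : L∘S → 1. Let L̄ : B → A^G be the induced functor into the Eilenberg–Moore category of G-comodules, sending B to (L(B), α_B), and let t : L∘S → G be the composite (Gσ)∘(αS). Then L̄ is an equivalence of categories if and only if L is comonadic and t is an isomorphism of functors. -/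
/-!
STATEMENT 3: Let `G` be a comonad on `A`, `L : B ⥤ A` a functor with a left
`G`-comodule structure `α : L ⟶ G∘L` and a right adjoint `S` with counit
`σ : L∘S ⟶ 1`. Let `L̄ : B ⥤ A^G` be the induced functor `B ↦ (L(B), α_B)` and
`t : L∘S ⟶ G` the composite `(Gσ) ∘ (αS)`. Then `L̄` is an equivalence iff `L` is
comonadic and `t` is an isomorphism of functors.
-/

open CategoryTheory

variable {A B : Type*} [Category A] [Category B]

/-- The functor `B ⥤ A^G` induced by a left `G`-comodule structure `α` on `L`. -/
@[simps] def comoduleComparison (G : Comonad A) (L : B ⥤ A) (α : L ⟶ L ⋙ G.toFunctor)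
    (hα₁ : ∀ X : B, α.app X ≫ G.ε.app (L.obj X) = 𝟙 (L.obj X))
    (hα₂ : ∀ X : B, α.app X ≫ G.δ.app (L.obj X) =
      α.app X ≫ G.toFunctor.map (α.app X)) :
    B ⥤ G.Coalgebra where
  obj X :=
    { A := L.obj X
      a := α.app X
      counit := hα₁ X
      coassoc := hα₂ X }
  map {X Y} f :=
    { f := L.map f
      h := (α.naturality f).symm }
  map_id X := by ext; simp
  map_comp f g := by ext; simp

/-- The comonad morphism `t : L∘S ⟶ G` associated to the comodule structure `α`
and an adjunction `L ⊣ S`. -/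
@[simps] def comoduleCanonicalMorphism (G : Comonad A) (L : B ⥤ A) {S : A ⥤ B}
    (adj : L ⊣ S) (α : L ⟶ L ⋙ G.toFunctor) : S ⋙ L ⟶ G.toFunctor where
  app Z := α.app (S.obj Z) ≫ G.toFunctor.map (adj.counit.app Z)
  naturality Z Z' f := by
    dsimp
    have h1 := α.naturality (S.map f)
    dsimp at h1
    have h2 : L.map (S.map f) ≫ adj.counit.app Z' = adj.counit.app Z ≫ f := by simp
    slice_lhs 1 2 => rw [h1]
    slice_lhs 2 3 => rw [← Functor.map_comp, h2]
    simp [Functor.map_comp]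

namespace CategoryTheory.Comonad

/-- A morphism of comonads `M ⟶ N` induces a functor from `M`-coalgebras to `N`-coalgebras. -/
@[simps] def coalgebraFunctorOfComonadHom {M N : Comonad A} (h : M ⟶ N) :
    M.Coalgebra ⥤ N.Coalgebra where
  obj X :=
    { A := X.A
      a := X.a ≫ h.app X.A
      counit := by simp [X.counit]
      coassoc := by
        rw [Category.assoc, h.app_δ, X.coassoc_assoc]
        simp }
  map f := { f := f.f
             h := by simp [← f.h_assoc] }

/-- Isomorphic comonads have equivalent categories of coalgebras. -/
def coalgebraEquivOfIsoComonads {M N : Comonad A} (e : M ≅ N) :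
    M.Coalgebra ≌ N.Coalgebra where
  functor := coalgebraFunctorOfComonadHom e.hom
  inverse := coalgebraFunctorOfComonadHom e.inv
  unitIso := NatIso.ofComponents (fun X => Coalgebra.isoMk (Iso.refl X.A) (by
    have h : e.hom.app X.A ≫ e.inv.app X.A = 𝟙 _ :=
      congrArg (fun f : M ⟶ M => f.app X.A) e.hom_inv_id
    change X.a ≫ M.map (𝟙 X.A) = 𝟙 X.A ≫ (X.a ≫ e.hom.app X.A) ≫ e.inv.app X.A
    simp [h])) (fun f =>
      Coalgebra.Hom.ext ((Category.comp_id f.f).trans (Category.id_comp f.f).symm))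
  counitIso := NatIso.ofComponents (fun X => Coalgebra.isoMk (Iso.refl X.A) (by
    have h : e.inv.app X.A ≫ e.hom.app X.A = 𝟙 _ :=
      congrArg (fun f : N ⟶ N => f.app X.A) e.inv_hom_id
    change ((X.a ≫ e.inv.app X.A) ≫ e.hom.app X.A) ≫ N.map (𝟙 X.A) = 𝟙 X.A ≫ X.a
    simp [h])) (fun f =>
      Coalgebra.Hom.ext ((Category.comp_id f.f).trans (Category.id_comp f.f).symm))
  functor_unitIso_comp X := Coalgebra.Hom.ext (Category.comp_id (𝟙 X.A))

/-- A coalgebra morphism into a cofree coalgebra is determined by its composite with the counit. -/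
theorem cofree_hom_ext {G : Comonad A} {X : G.Coalgebra} {Z : A} {u v : X.A ⟶ G.obj Z}
    (hu : X.a ≫ G.map u = u ≫ G.δ.app Z) (hv : X.a ≫ G.map v = v ≫ G.δ.app Z)
    (h : u ≫ G.ε.app Z = v ≫ G.ε.app Z) : u = v := by
  have key (w : X.A ⟶ G.obj Z) (hw : X.a ≫ G.map w = w ≫ G.δ.app Z) :
      X.a ≫ G.map (w ≫ G.ε.app Z) = w := by
    rw [G.map_comp, reassoc_of% hw, G.right_counit, Category.comp_id]
  rw [← key u hu, h, key v hv]

end CategoryTheory.Comonad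

section

variable (G : Comonad A) (L : B ⥤ A) {S : A ⥤ B} (adj : L ⊣ S) (α : L ⟶ L ⋙ G.toFunctor)

theorem comoduleCanonicalMorphism_app_counit
    (hα₁ : ∀ X : B, α.app X ≫ G.ε.app (L.obj X) = 𝟙 (L.obj X)) (Z : A) :
    (comoduleCanonicalMorphism G L adj α).app Z ≫ G.ε.app Z = adj.counit.app Z := by
  have h : G.map (adj.counit.app Z) ≫ G.ε.app Z =
      G.ε.app (L.obj (S.obj Z)) ≫ adj.counit.app Z := G.ε.naturality (adj.counit.app Z)
  change (α.app (S.obj Z) ≫ G.map (adj.counit.app Z)) ≫ G.ε.app Z = _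
  rw [Category.assoc, h, reassoc_of% hα₁]

theorem map_unit_comoduleCanonicalMorphism_app (X : B) :
    L.map (adj.unit.app X) ≫ (comoduleCanonicalMorphism G L adj α).app (L.obj X) = α.app X := by
  have h : L.map (adj.unit.app X) ≫ α.app (S.obj (L.obj X)) =
      α.app X ≫ G.map (L.map (adj.unit.app X)) := α.naturality (adj.unit.app X)
  change L.map (adj.unit.app X) ≫ α.app (S.obj (L.obj X)) ≫ G.map (adj.counit.app (L.obj X)) = _
  rw [reassoc_of% h, ← G.map_comp, adj.left_triangle_components]
  simp

theorem comoduleCanonicalMorphism_app_comul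
    (hα₂ : ∀ X : B, α.app X ≫ G.δ.app (L.obj X) = α.app X ≫ G.toFunctor.map (α.app X)) (Z : A) :
    (comoduleCanonicalMorphism G L adj α).app Z ≫ G.δ.app Z =
      α.app (S.obj Z) ≫ G.map ((comoduleCanonicalMorphism G L adj α).app Z) := by
  have h : G.map (adj.counit.app Z) ≫ G.δ.app Z =
      G.δ.app (L.obj (S.obj Z)) ≫ G.map (G.map (adj.counit.app Z)) :=
    G.δ.naturality (adj.counit.app Z)
  change (α.app (S.obj Z) ≫ G.map (adj.counit.app Z)) ≫ G.δ.app Z =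
    α.app (S.obj Z) ≫ G.map (α.app (S.obj Z) ≫ G.map (adj.counit.app Z))
  rw [Category.assoc, h, reassoc_of% hα₂, ← G.map_comp]

variable (hα₁ : ∀ X : B, α.app X ≫ G.ε.app (L.obj X) = 𝟙 (L.obj X))
  (hα₂ : ∀ X : B, α.app X ≫ G.δ.app (L.obj X) = α.app X ≫ G.toFunctor.map (α.app X))

/-- If the canonical morphism is invertible, it is an isomorphism of comonads. -/
noncomputable def comoduleCanonicalIso [IsIso (comoduleCanonicalMorphism G L adj α)] :
    adj.toComonad ≅ G :=
  let t : adj.toComonad.toFunctor ≅ G.toFunctor :=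
    @asIso (A ⥤ A) _ (S ⋙ L) G.toFunctor (comoduleCanonicalMorphism G L adj α) inferInstance
  ComonadIso.mk t (comoduleCanonicalMorphism_app_counit G L adj α hα₁) (fun Z => by
    change (comoduleCanonicalMorphism G L adj α).app Z ≫ G.δ.app Z =
      L.map (adj.unit.app (S.obj Z)) ≫
        (comoduleCanonicalMorphism G L adj α).app (L.obj (S.obj Z)) ≫
        G.map ((comoduleCanonicalMorphism G L adj α).app Z)
    rw [comoduleCanonicalMorphism_app_comul G L adj α hα₂,
      ← map_unit_comoduleCanonicalMorphism_app G L adj α (S.obj Z), Category.assoc])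

/-- When the canonical morphism is invertible, the comparison functor of `α` factors through the
comparison functor of the adjunction. -/
noncomputable def comparisonCompIsoComoduleComparison
    [IsIso (comoduleCanonicalMorphism G L adj α)] :
    Comonad.comparison adj ⋙ (Comonad.coalgebraEquivOfIsoComonads
      (comoduleCanonicalIso G L adj α hα₁ hα₂)).functor ≅ comoduleComparison G L α hα₁ hα₂ :=
  NatIso.ofComponents (fun X => Comonad.Coalgebra.isoMk (Iso.refl (L.obj X)) (by
    change (L.map (adj.unit.app X) ≫ (comoduleCanonicalMorphism G L adj α).app (L.obj X)) ≫
      G.map (𝟙 (L.obj X)) = 𝟙 (L.obj X) ≫ α.app X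
    rw [map_unit_comoduleCanonicalMorphism_app]
    simp)) (fun f => by
      ext
      exact (Category.comp_id _).trans (Category.id_comp _).symm)

theorem comoduleComparison_isEquivalence_iff_comparison
    [IsIso (comoduleCanonicalMorphism G L adj α)] :
    (comoduleComparison G L α hα₁ hα₂).IsEquivalence ↔
      (Comonad.comparison adj).IsEquivalence := by
  have e := comparisonCompIsoComoduleComparison G L adj α hα₁ hα₂
  constructor
  · intro h
    have := Functor.isEquivalence_of_iso e.symm
    exact Functor.isEquivalence_of_comp_right _ (Comonad.coalgebraEquivOfIsoComonads
      (comoduleCanonicalIso G L adj α hα₁ hα₂)).functor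
  · intro h
    exact Functor.isEquivalence_of_iso e

/-- Being an equivalence, for the comparison functor of an adjunction, does not depend on the
choice of right adjoint. -/
theorem comparison_isEquivalence_of_comparison {S' : A ⥤ B} (adj' : L ⊣ S')
    [h : (Comonad.comparison adj').IsEquivalence] : (Comonad.comparison adj).IsEquivalence := by
  let β : L ⟶ L ⋙ adj.toComonad.toFunctor := Functor.whiskerRight adj.unit L
  have ht : comoduleCanonicalMorphism adj.toComonad L adj' β =
      (Functor.isoWhiskerRight (adj'.rightAdjointUniq adj) L).hom := by
    ext Z
    change L.map (adj.unit.app (S'.obj Z)) ≫ L.map (S.map (adj'.counit.app Z)) =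
      L.map ((adj'.rightAdjointUniq adj).hom.app Z)
    rw [← L.map_comp]
    congr 1
    apply (adj.homEquiv _ _).symm.injective
    simp [Adjunction.homEquiv_counit]
  have : IsIso (comoduleCanonicalMorphism adj.toComonad L adj' β) := by
    rw [ht]
    exact (Functor.isoWhiskerRight (adj'.rightAdjointUniq adj) L).isIso_hom
  exact (comoduleComparison_isEquivalence_iff_comparison adj.toComonad L adj' β
    (fun X => ((Comonad.comparison adj).obj X).counit)
    (fun X => ((Comonad.comparison adj).obj X).coassoc)).2 h

theorem isIso_comoduleCanonicalMorphism_of_isEquivalence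
    [(comoduleComparison G L α hα₁ hα₂).IsEquivalence] :
    IsIso (comoduleCanonicalMorphism G L adj α) := by
  let E := comoduleComparison G L α hα₁ hα₂
  suffices ∀ Z, IsIso ((comoduleCanonicalMorphism G L adj α).app Z) from
    NatIso.isIso_of_isIso_app _
  intro Z
  let f : E.obj (S.obj Z) ⟶ G.cofree.obj Z :=
    { f := (comoduleCanonicalMorphism G L adj α).app Z
      h := (comoduleCanonicalMorphism_app_comul G L adj α hα₂ Z).symm }
  let X := E.objPreimage (G.cofree.obj Z)
  let e : E.obj X ≅ G.cofree.obj Z := E.objObjPreimageIso _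
  let e' : L.obj X ⟶ G.obj Z := e.hom.f
  let g : X ⟶ S.obj Z := adj.homEquiv _ _ (e' ≫ G.ε.app Z)
  have hg : L.map g ≫ adj.counit.app Z = e' ≫ G.ε.app Z := by
    simp [g, Adjunction.homEquiv_unit]
  have h₁ : E.map g ≫ f = e.hom := Comonad.Coalgebra.Hom.ext <| by
    refine Comonad.cofree_hom_ext (E.map g ≫ f).h e.hom.h ?_
    change (L.map g ≫ (comoduleCanonicalMorphism G L adj α).app Z) ≫ G.ε.app Z = e' ≫ G.ε.app Z
    rw [Category.assoc, comoduleCanonicalMorphism_app_counit G L adj α hα₁, hg]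
  obtain ⟨k, hk⟩ := E.map_surjective (f ≫ e.inv)
  have hk' : L.map k ≫ e' = (comoduleCanonicalMorphism G L adj α).app Z :=
    congrArg Comonad.Coalgebra.Hom.f (show E.map k ≫ e.hom = f by simp [hk])
  have h₂ : k ≫ g = 𝟙 _ := (adj.homEquiv _ _).symm.injective (by
    rw [adj.homEquiv_counit, adj.homEquiv_counit, L.map_comp, Category.assoc, hg,
      reassoc_of% hk', comoduleCanonicalMorphism_app_counit G L adj α hα₁]
    simp)
  have : IsIso f := ⟨e.inv ≫ E.map g, by
    rw [← Category.assoc, ← hk, ← E.map_comp, h₂, E.map_id], by simp [h₁]⟩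
  exact inferInstanceAs (IsIso (G.forget.map f))

end

theorem comoduleComparison_isEquivalence_iff_comonadic_and_galois
    (G : Comonad A) (L : B ⥤ A) {S : A ⥤ B} (adj : L ⊣ S)
    (α : L ⟶ L ⋙ G.toFunctor)
    (hα₁ : ∀ X : B, α.app X ≫ G.ε.app (L.obj X) = 𝟙 (L.obj X))
    (hα₂ : ∀ X : B, α.app X ≫ G.δ.app (L.obj X) =
      α.app X ≫ G.toFunctor.map (α.app X)) :
    (comoduleComparison G L α hα₁ hα₂).IsEquivalence ↔
      (Nonempty (ComonadicLeftAdjoint L) ∧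
        IsIso (comoduleCanonicalMorphism G L adj α)) := by
  constructor
  · intro h
    have := isIso_comoduleCanonicalMorphism_of_isEquivalence G L adj α hα₁ hα₂
    exact ⟨⟨⟨S, adj, (comoduleComparison_isEquivalence_iff_comparison G L adj α hα₁ hα₂).1 h⟩⟩, this⟩
  · rintro ⟨⟨h⟩, _⟩
    exact (comoduleComparison_isEquivalence_iff_comparison G L adj α hα₁ hα₂).2
      (comparison_isEquivalence_of_comparison L adj (comonadicAdjunction L))
end

section
/- Let U : A → B and F : B → A be functors, and suppose there exist natural transformations κ : 1_A → F∘U and κ' : F∘U → 1_A with κ'∘κ = id. Then both F∘U and U are separable functors; in particular there is a family of maps P_{X,Y} : B(U(X),U(Y)) → A(X,Y) such that P(U(f)) = f for every f : X → Y in A, and which is natural in X and Y, i.e. P((U f)∘h∘(U g)) = f∘P(h)∘g for all f : X → X', g : Y' → Y in A and h : U(X) → U(Y) in B (in diagrammatic order: P(U(g) ≫ h ≫ U(f)) = g ≫ P(h) ≫ f). -/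
/-!
STATEMENT 4: If `U : A ⥤ B` and `F : B ⥤ A` admit natural transformations
`κ : 1_A ⟶ F∘U` and `κ' : F∘U ⟶ 1_A` with `κ' ∘ κ = 1`, then both `F∘U` and `U` are
separable functors: there are natural retractions of their actions on Hom-sets.
-/

open CategoryTheory

/-- A functor `U` is separable if its action on Hom-sets admits a natural retraction. -/
def IsSeparableFunctor {A B : Type*} [Category A] [Category B] (U : A ⥤ B) : Prop :=
  ∃ P : ∀ X Y : A, (U.obj X ⟶ U.obj Y) → (X ⟶ Y),
    (∀ (X Y : A) (f : X ⟶ Y), P X Y (U.map f) = f) ∧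
    (∀ (X X' Y Y' : A) (g : X' ⟶ X) (f : Y ⟶ Y') (h : U.obj X ⟶ U.obj Y),
      P X' Y' (U.map g ≫ h ≫ U.map f) = g ≫ P X Y h ≫ f)

/-- If a composite `U ⋙ F` is separable, then so is its first factor `U`. -/
theorem IsSeparableFunctor.of_comp {A B C : Type*} [Category A] [Category B] [Category C]
    {U : A ⥤ B} {F : B ⥤ C} (h : IsSeparableFunctor (U ⋙ F)) : IsSeparableFunctor U := by
  obtain ⟨P, hP, hnat⟩ := h
  refine ⟨fun X Y h => P X Y (F.map h), fun X Y f => hP X Y f, fun X X' Y Y' g f h => ?_⟩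
  simpa using hnat X X' Y Y' g f (F.map h)

/-- An endofunctor of which the identity functor is a retract is separable. -/
theorem IsSeparableFunctor.of_retract_id {A : Type*} [Category A] {T : A ⥤ A}
    (κ : 𝟭 A ⟶ T) (κ' : T ⟶ 𝟭 A) (hκ : κ ≫ κ' = 𝟙 (𝟭 A)) : IsSeparableFunctor T := by
  refine ⟨fun X Y h => κ.app X ≫ h ≫ κ'.app Y, fun X Y f => ?_, fun X X' Y Y' g f h => ?_⟩
  · have hX : κ.app X ≫ κ'.app X = 𝟙 X := NatTrans.congr_app hκ X
    have hf : T.map f ≫ κ'.app Y = κ'.app X ≫ f := κ'.naturality f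
    simp only [hf, reassoc_of% hX]
  · have hg : g ≫ κ.app X = κ.app X' ≫ T.map g := κ.naturality g
    have hf : T.map f ≫ κ'.app Y' = κ'.app Y ≫ f := κ'.naturality f
    simp only [Category.assoc, hf, reassoc_of% hg]

theorem separable_of_split_natural_section
    {A B : Type*} [Category A] [Category B] (U : A ⥤ B) (F : B ⥤ A)
    (κ : 𝟭 A ⟶ U ⋙ F) (κ' : U ⋙ F ⟶ 𝟭 A) (hκ : κ ≫ κ' = 𝟙 (𝟭 A)) :
    IsSeparableFunctor (U ⋙ F) ∧ IsSeparableFunctor U := by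
  have h : IsSeparableFunctor (U ⋙ F) := .of_retract_id κ κ' hκ
  exact ⟨h, h.of_comp⟩
end

section
/- Let F=(F,m,e) be a monad on a category A and let λ : F∘F → F∘F be a BD-law on F. Then F^λ := (F, m∘λ, e) is again a monad on A; that is, the multiplication m∘λ is associative and unital with unit e. -/
/-!
STATEMENT 5: If `F = (F, m, e)` is a monad on `A` and `λ : F∘F ⟶ F∘F` is a BD-law
(a monad distributive law of `F` over itself satisfying the Yang–Baxter equation),
then `F^λ = (F, m∘λ, e)` is again a monad: `m∘λ` is associative and unital with unit `e`.
All equations are stated componentwise.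
-/

open CategoryTheory

theorem opposite_monad_of_BD_law
    {A : Type*} [Category A] (F : A ⥤ A) (m : F ⋙ F ⟶ F) (e : 𝟭 A ⟶ F)
    -- monad axioms for F = (F, m, e)
    (hF₁ : ∀ X : A, e.app (F.obj X) ≫ m.app X = 𝟙 (F.obj X))
    (hF₂ : ∀ X : A, F.map (e.app X) ≫ m.app X = 𝟙 (F.obj X))
    (hF₃ : ∀ X : A, m.app (F.obj X) ≫ m.app X = F.map (m.app X) ≫ m.app X)
    -- λ : F∘F ⟶ F∘F is a distributive law of F over itself:
    (lam : F ⋙ F ⟶ F ⋙ F)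
    -- λ ∘ (eF) = Fe
    (hd₁ : ∀ X : A, e.app (F.obj X) ≫ lam.app X = F.map (e.app X))
    -- λ ∘ (Fe) = eF
    (hd₂ : ∀ X : A, F.map (e.app X) ≫ lam.app X = e.app (F.obj X))
    -- λ ∘ (mF) = (Fm) ∘ (λF) ∘ (Fλ)
    (hd₃ : ∀ X : A, m.app (F.obj X) ≫ lam.app X =
      F.map (lam.app X) ≫ lam.app (F.obj X) ≫ F.map (m.app X))
    -- λ ∘ (Fm) = (mF) ∘ (Fλ) ∘ (λF)
    (hd₄ : ∀ X : A, F.map (m.app X) ≫ lam.app X =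
      lam.app (F.obj X) ≫ F.map (lam.app X) ≫ m.app (F.obj X))
    -- Yang–Baxter: (λF) ∘ (Fλ) ∘ (λF) = (Fλ) ∘ (λF) ∘ (Fλ)
    (hYB : ∀ X : A, lam.app (F.obj X) ≫ F.map (lam.app X) ≫ lam.app (F.obj X) =
      F.map (lam.app X) ≫ lam.app (F.obj X) ≫ F.map (lam.app X)) :
    -- F^λ = (F, m∘λ, e) is a monad:
    (∀ X : A, e.app (F.obj X) ≫ lam.app X ≫ m.app X = 𝟙 (F.obj X)) ∧
    (∀ X : A, F.map (e.app X) ≫ lam.app X ≫ m.app X = 𝟙 (F.obj X)) ∧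
    (∀ X : A, (lam.app (F.obj X) ≫ m.app (F.obj X)) ≫ lam.app X ≫ m.app X =
      F.map (lam.app X ≫ m.app X) ≫ lam.app X ≫ m.app X) := by
  refine ⟨fun X => ?_, fun X => ?_, fun X => ?_⟩
  · rw [reassoc_of% hd₁ X, hF₂]
  · rw [reassoc_of% hd₂ X, hF₁]
  · have yangBaxter := hYB X
    have assoc := hF₃ X
    have mul_left := hd₃ X
    have mul_right := hd₄ X
    dsimp only [Functor.comp_obj] at yangBaxter assoc mul_left mul_right ⊢
    simp only [Functor.map_comp, Category.assoc]
    rw [reassoc_of% mul_left, reassoc_of% mul_right, ← reassoc_of% yangBaxter, assoc]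
end

section
/- Let (V,⊗,I,τ) be a braided monoidal category admitting equalisers and coequalisers, and let X be a finite object of V with left dual (X*, db : I → X⊗X*, ev : X*⊗X → I). Then the following are equivalent: (a) the functor X⊗− : V → V is conservative; (b) ev : X*⊗X → I is a copure epimorphism (for every object Y, ev⊗Y is a regular epimorphism); (c) the functor −⊗X : V → V is conservative; (d) db : I → X⊗X* is a pure monomorphism (for every object Y, db⊗Y is a regular monomorphism). -/
/-!
STATEMENT 7: In a braided monoidal category `V` with equalisers and coequalisers, for
a finite object `X` with left dual `(Xs, db, ev)`, the following are equivalent: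
(a) `X ⊗ −` is conservative; (b) `ev` is a copure epimorphism; (c) `− ⊗ X` is
conservative; (d) `db` is a pure monomorphism.
-/

open CategoryTheory MonoidalCategory CategoryTheory.Limits

namespace CategoryTheory.Adjunction

variable {C D : Type*} [Category C] [Category D] {F : C ⥤ D} {G : D ⥤ C} (adj : F ⊣ G)

/-- The image under the right adjoint of the canonical presentation `FGFGY ⇉ FGY ⟶ Y` is a
split coequalizer. -/
def counitIsSplitCoequalizer (Y : D) :
    IsSplitCoequalizer (G.map (F.map (G.map (adj.counit.app Y))))
      (G.map (adj.counit.app (F.obj (G.obj Y)))) (G.map (adj.counit.app Y)) where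
  rightSection := adj.unit.app (G.obj Y)
  leftSection := adj.unit.app (G.obj (F.obj (G.obj Y)))
  condition := by
    rw [← G.map_comp, ← G.map_comp]
    exact congrArg G.map (adj.counit_naturality _)
  rightSection_π := adj.right_triangle_components Y
  leftSection_bottom := adj.right_triangle_components _
  leftSection_top := adj.unit_naturality _

theorem isRegularEpi_counit_app_of_reflectsIsomorphisms [HasCoequalizers D] [G.IsLeftAdjoint]
    [G.ReflectsIsomorphisms] (Y : D) : IsRegularEpi (adj.counit.app Y) := by
  have : PreservesColimitsOfSize.{0, 0} G :=
    (Adjunction.ofIsLeftAdjoint G).leftAdjoint_preservesColimits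
  have := reflectsColimit_of_reflectsIsomorphisms
    (parallelPair (F.map (G.map (adj.counit.app Y))) (adj.counit.app (F.obj (G.obj Y)))) G
  exact ⟨⟨{
    W := _
    left := F.map (G.map (adj.counit.app Y))
    right := adj.counit.app (F.obj (G.obj Y))
    w := adj.counit_naturality _
    isColimit := isColimitOfIsColimitCoforkMap G _ (adj.counitIsSplitCoequalizer Y).isCoequalizer }⟩⟩

theorem reflectsIsomorphisms_of_isRegularEpi_counit_app
    (h : ∀ Y, IsRegularEpi (adj.counit.app Y)) : G.ReflectsIsomorphisms where
  reflects {A B} f _ := by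
    have := adj.faithful_R_of_epi_counit_app
    have : Mono f := G.mono_of_mono_map inferInstance
    have : StrongEpi (adj.counit.app A ≫ f) := by
      have : StrongEpi (F.map (G.map f) ≫ adj.counit.app B) := inferInstance
      exact adj.counit_naturality f ▸ this
    have := strongEpi_of_strongEpi (adj.counit.app A) f
    exact isIso_of_mono_of_strongEpi f

/-- The right adjoint is conservative iff the counit is a pointwise regular epimorphism. -/
theorem reflectsIsomorphisms_right_iff [HasCoequalizers D] [G.IsLeftAdjoint] :
    G.ReflectsIsomorphisms ↔ ∀ Y, IsRegularEpi (adj.counit.app Y) :=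
  ⟨fun _ => adj.isRegularEpi_counit_app_of_reflectsIsomorphisms,
    adj.reflectsIsomorphisms_of_isRegularEpi_counit_app⟩

/-- The left adjoint is conservative iff the unit is a pointwise regular monomorphism. -/
theorem reflectsIsomorphisms_left_iff [HasEqualizers C] [F.IsRightAdjoint] :
    F.ReflectsIsomorphisms ↔ ∀ X, IsRegularMono (adj.unit.app X) := by
  have : F.op.IsLeftAdjoint := (Adjunction.ofIsRightAdjoint F).op.isLeftAdjoint
  have h := adj.op.reflectsIsomorphisms_right_iff
  have hF : F.op.ReflectsIsomorphisms ↔ F.ReflectsIsomorphisms :=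
    ⟨fun _ => ⟨fun f _ => by
      have : IsIso (F.op.map f.op) := inferInstanceAs (IsIso (F.map f).op)
      exact (isIso_op_iff f).1 (isIso_of_reflects_iso f.op F.op)⟩, fun _ => ⟨fun f _ => by
      have : IsIso (F.map f.unop) := inferInstanceAs (IsIso (F.op.map f).unop)
      exact (isIso_unop_iff f).1 (isIso_of_reflects_iso f.unop F)⟩⟩
  rw [← hF, h]
  exact ⟨fun h X => (isRegularEpi_op_iff_isRegularMono _).1 (h (.op X)),
    fun h X => (isRegularEpi_op_iff_isRegularMono _).2 (h X.unop)⟩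

/-- Any morphism `G.map f` in the image of the right adjoint is a retract of its image under
`F ⋙ G`. -/
def retractArrowRight {A B : D} (f : A ⟶ B) :
    RetractArrow (G.map f) (G.map (F.map (G.map f))) where
  i := Arrow.homMk (adj.unit.app (G.obj A)) (adj.unit.app (G.obj B))
    (adj.unit_naturality (G.map f))
  r := Arrow.homMk (G.map (adj.counit.app A)) (G.map (adj.counit.app B)) (by
    dsimp only [Arrow.mk_hom]
    rw [← G.map_comp, ← G.map_comp]
    exact congrArg G.map (adj.counit_naturality f).symm)
  retract := Arrow.hom_ext _ _ (adj.right_triangle_components A) (adj.right_triangle_components B)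

/-- Any morphism `F.map f` in the image of the left adjoint is a retract of its image under
`G ⋙ F`. -/
def retractArrowLeft {A B : C} (f : A ⟶ B) :
    RetractArrow (F.map f) (F.map (G.map (F.map f))) where
  i := Arrow.homMk (F.map (adj.unit.app A)) (F.map (adj.unit.app B)) (by
    dsimp only [Arrow.mk_hom]
    rw [← F.map_comp, ← F.map_comp]
    exact congrArg F.map (adj.unit_naturality f))
  r := Arrow.homMk (adj.counit.app (F.obj A)) (adj.counit.app (F.obj B))
    (adj.counit_naturality (F.map f)).symm
  retract := Arrow.hom_ext _ _ (adj.left_triangle_components A) (adj.left_triangle_components B)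

/-- If the composites of two adjoint endofunctors in either order are isomorphic, then both
functors invert the same morphisms. -/
theorem isIso_map_iff_of_comp_iso {F G : C ⥤ C} (adj : F ⊣ G) (e : F ⋙ G ≅ G ⋙ F)
    {A B : C} (f : A ⟶ B) : IsIso (F.map f) ↔ IsIso (G.map f) := by
  constructor <;> intro _
  · have : IsIso ((F ⋙ G).map f) := inferInstanceAs (IsIso (G.map (F.map f)))
    have : IsIso (F.map (G.map f)) := (NatIso.isIso_map_iff e f).1 this
    exact MorphismProperty.of_retract (P := .isomorphisms C) (adj.retractArrowRight f)
      (.infer_property _)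
  · have : IsIso ((G ⋙ F).map f) := inferInstanceAs (IsIso (F.map (G.map f)))
    have : IsIso (G.map (F.map f)) := (NatIso.isIso_map_iff e f).2 this
    exact MorphismProperty.of_retract (P := .isomorphisms C) (adj.retractArrowLeft f)
      (.infer_property _)

theorem reflectsIsomorphisms_iff_of_comp_iso {F G : C ⥤ C} (adj : F ⊣ G) (e : F ⋙ G ≅ G ⋙ F) :
    F.ReflectsIsomorphisms ↔ G.ReflectsIsomorphisms :=
  ⟨fun _ => ⟨fun f h => by
      have := (adj.isIso_map_iff_of_comp_iso e f).2 h
      exact isIso_of_reflects_iso f F⟩,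
    fun _ => ⟨fun f h => by
      have := (adj.isIso_map_iff_of_comp_iso e f).1 h
      exact isIso_of_reflects_iso f G⟩⟩

end CategoryTheory.Adjunction

namespace CategoryTheory.MonoidalCategory

variable {C : Type*} [Category C] [MonoidalCategory C]

/-- Left tensoring by two objects of a braided category commutes up to isomorphism. -/
def tensorLeftCompComm [BraidedCategory C] (X Y : C) :
    tensorLeft X ⋙ tensorLeft Y ≅ tensorLeft Y ⋙ tensorLeft X :=
  (tensorLeftTensor Y X).symm ≪≫ (curriedTensor C).mapIso (β_ Y X) ≪≫ tensorLeftTensor X Y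

theorem tensorLeftAdjunction_counit_app (X Xs Y : C) [ExactPairing X Xs] :
    (tensorLeftAdjunction X Xs).counit.app Y = (α_ Xs X Y).inv ≫ ε_ X Xs ▷ Y ≫ (λ_ Y).hom := by
  simp [tensorLeftAdjunction, tensorLeftHomEquiv]

theorem tensorLeftAdjunction_unit_app (X Xs Y : C) [ExactPairing X Xs] :
    (tensorLeftAdjunction X Xs).unit.app Y = (λ_ Y).inv ≫ η_ X Xs ▷ Y ≫ (α_ X Xs Y).hom := by
  simp [tensorLeftAdjunction, tensorLeftHomEquiv]

theorem isRegularEpi_tensorLeftAdjunction_counit_app_iff (X Xs Y : C) [ExactPairing X Xs] :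
    IsRegularEpi ((tensorLeftAdjunction X Xs).counit.app Y) ↔ IsRegularEpi (ε_ X Xs ▷ Y) := by
  rw [tensorLeftAdjunction_counit_app]
  exact ((MorphismProperty.regularEpi C).cancel_left_of_respectsIso _ _).trans
    ((MorphismProperty.regularEpi C).cancel_right_of_respectsIso _ _)

theorem isRegularMono_tensorLeftAdjunction_unit_app_iff (X Xs Y : C) [ExactPairing X Xs] :
    IsRegularMono ((tensorLeftAdjunction X Xs).unit.app Y) ↔ IsRegularMono (η_ X Xs ▷ Y) := by
  rw [tensorLeftAdjunction_unit_app]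
  exact ((MorphismProperty.regularMono C).cancel_left_of_respectsIso _ _).trans
    ((MorphismProperty.regularMono C).cancel_right_of_respectsIso _ _)

end CategoryTheory.MonoidalCategory

theorem finite_object_conservative_tfae
    {V : Type*} [Category V] [MonoidalCategory V] [BraidedCategory V]
    [HasEqualizers V] [HasCoequalizers V]
    (X Xs : V) (db : 𝟙_ V ⟶ X ⊗ Xs) (ev : Xs ⊗ X ⟶ 𝟙_ V)
    (h₁ : (db ▷ X) ≫ (α_ X Xs X).hom ≫ (X ◁ ev) = (λ_ X).hom ≫ (ρ_ X).inv)
    (h₂ : (Xs ◁ db) ≫ (α_ Xs X Xs).inv ≫ (ev ▷ Xs) = (ρ_ Xs).hom ≫ (λ_ Xs).inv) :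
    ((tensorLeft X).ReflectsIsomorphisms ↔ ∀ Y : V, Nonempty (RegularEpi (ev ▷ Y))) ∧
    ((tensorLeft X).ReflectsIsomorphisms ↔ (tensorRight X).ReflectsIsomorphisms) ∧
    ((tensorLeft X).ReflectsIsomorphisms ↔ ∀ Y : V, Nonempty (RegularMono (db ▷ Y))) := by
  let : ExactPairing X Xs := ⟨db, ev, h₂, h₁⟩
  have : (tensorLeft X).IsLeftAdjoint :=
    ((tensorRightAdjunction X Xs).ofNatIsoLeft
      (BraidedCategory.tensorLeftIsoTensorRight X).symm).isLeftAdjoint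
  have : (tensorLeft Xs).IsRightAdjoint :=
    ((tensorRightAdjunction X Xs).ofNatIsoRight
      (BraidedCategory.tensorLeftIsoTensorRight Xs).symm).isRightAdjoint
  let adj := tensorLeftAdjunction X Xs
  refine ⟨adj.reflectsIsomorphisms_right_iff.trans <| forall_congr' fun Y => ?_,
    reflectsIsomorphisms_iso_iff (BraidedCategory.tensorLeftIsoTensorRight X),
    (adj.reflectsIsomorphisms_iff_of_comp_iso (tensorLeftCompComm Xs X)).symm.trans <|
      adj.reflectsIsomorphisms_left_iff.trans <| forall_congr' fun Y => ?_⟩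
  · exact (isRegularEpi_tensorLeftAdjunction_counit_app_iff X Xs Y).trans
      ⟨fun h => h.regularEpi, fun h => ⟨h⟩⟩
  · exact (isRegularMono_tensorLeftAdjunction_unit_app_iff X Xs Y).trans
      ⟨fun h => h.regularMono, fun h => ⟨h⟩⟩
end

section
/- Let R be a commutative ring and A an R-algebra. Then A is an Azumaya R-algebra if and only if the unit map R → A is a pure monomorphism of R-modules and for every right A-module M the R-linear map A ⊗_R M → Hom_R(A, M) sending a ⊗ m to the map b ↦ m·(b a) is bijective. -/
/-!
STATEMENT 15: A (commutative-base) algebra `A` over `R` is Azumaya iff the unit map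
`R → A` is a pure monomorphism of `R`-modules and for every right `A`-module `M` the
map `A ⊗[R] M → Hom_R(A, M)`, `a ⊗ m ↦ (b ↦ m·(b*a))`, is bijective.
(`IsAzumaya` is spelled out as in Mathlib: finitely generated projective, faithful,
and `A ⊗ Aᵐᵒᵖ → End_R(A)`, `a ⊗ b ↦ (c ↦ a*c*b)`, bijective.)
-/

open TensorProduct

universe u

section Defs

variable (R A : Type u) [CommRing R] [Ring A] [Algebra R A]

/-- The natural algebra map `A ⊗[R] Aᵐᵒᵖ → End_R(A)`, `a ⊗ b ↦ (c ↦ a * c * b)`,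
as an `R`-linear map. -/
noncomputable def mulLeftRightMap : A ⊗[R] Aᵐᵒᵖ →ₗ[R] Module.End R A :=
  TensorProduct.lift <| LinearMap.mk₂ R
    (fun a b => (LinearMap.mulRight R b.unop) ∘ₗ (LinearMap.mulLeft R a))
    (fun a₁ a₂ b => by ext c; simp [add_mul])
    (fun r a b => by ext c; simp [smul_mul_assoc])
    (fun a b₁ b₂ => by ext c; simp [mul_add])
    (fun r a b => by ext c; simp [mul_smul_comm])

/-- `A` is an Azumaya algebra over `R` (Mathlib's `IsAzumaya`, spelled out). -/
def IsAzumayaAlg : Prop :=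
  Module.Projective R A ∧ Module.Finite R A ∧ FaithfulSMul R A ∧
    Function.Bijective (mulLeftRightMap R A)

/-- The unit map `R → A` is a pure monomorphism of `R`-modules. -/
def UnitIsPure : Prop :=
  ∀ (M : Type u) [AddCommGroup M] [Module R M],
    Function.Injective (LinearMap.rTensor M (Algebra.linearMap R A))

/-- For a right `A`-module `M`, the map `A ⊗[R] M →ₗ[R] Hom_R(A, M)` sending
`a ⊗ m` to `b ↦ (b*a) • m` (where `(b*a) • m` denotes the right action `m · (b a)`). -/
noncomputable def rightModuleComparison (M : Type u) [AddCommGroup M] [Module R M]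
    [Module Aᵐᵒᵖ M] [IsScalarTower R Aᵐᵒᵖ M] :
    A ⊗[R] M →ₗ[R] (A →ₗ[R] M) :=
  TensorProduct.lift <| LinearMap.mk₂ R
    (fun a m =>
      { toFun := fun b => MulOpposite.op (b * a) • m
        map_add' := fun b₁ b₂ => by simp [add_mul, add_smul]
        map_smul' := fun r b => by simp [smul_mul_assoc] })
    (fun a₁ a₂ m => by ext b; simp [mul_add, add_smul])
    (fun r a m => by ext b; simp [mul_smul_comm])
    (fun a m₁ m₂ => by ext b; simp [smul_add])
    (fun r a m => by ext b; simp; rw [smul_comm])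

end Defs

open MulOpposite

section AzumayaCriterion

variable {R A : Type u} [CommRing R] [Ring A] [Algebra R A]

section Comparison

variable {M : Type u} [AddCommGroup M] [Module R M] [Module Aᵐᵒᵖ M] [IsScalarTower R Aᵐᵒᵖ M]

@[simp]
lemma rightModuleComparison_tmul (a b : A) (m : M) :
    rightModuleComparison R A M (a ⊗ₜ m) b = op (b * a) • m := rfl

@[simp]
lemma mulLeftRightMap_tmul (a c : A) (b : Aᵐᵒᵖ) :
    mulLeftRightMap R A (a ⊗ₜ b) c = a * c * b.unop := rfl

variable (R A) in
/-- The orbit map `a ↦ m · a` of an element `m` of a right module. -/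
def rightOrbitMap (m : M) : A →ₗ[R] M where
  toFun a := op a • m
  map_add' a b := by simp [add_smul]
  map_smul' r a := by simp

@[simp]
lemma rightOrbitMap_apply (m : M) (a : A) : rightOrbitMap R A m a = op a • m := rfl

lemma rightModuleComparison_lTensor_rightOrbitMap (m : M) (t : A ⊗[R] A) :
    rightModuleComparison R A M ((rightOrbitMap R A m).lTensor A t) =
      rightOrbitMap R A m ∘ₗ rightModuleComparison R A A t := by
  induction t with
  | zero => simp
  | add x y hx hy => simp only [map_add, hx, hy, LinearMap.comp_add]
  | tmul a x =>
    ext b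
    simp [mul_smul]

end Comparison

lemma rightModuleComparison_self_bijective_iff :
    Function.Bijective (rightModuleComparison R A A) ↔
      Function.Bijective (mulLeftRightMap R A) := by
  let e : A ⊗[R] Aᵐᵒᵖ ≃ₗ[R] A ⊗[R] A :=
    TensorProduct.congr (.refl R A) (opLinearEquiv R).symm ≪≫ₗ TensorProduct.comm R A A
  have h : mulLeftRightMap R A = rightModuleComparison R A A ∘ₗ e.toLinearMap := by
    ext a b c
    simp [e, mul_assoc]
  rw [h, LinearMap.coe_comp]
  exact (Function.Bijective.of_comp_iff _ e.bijective).symm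

theorem rightModuleComparison_bijective_of_self [Module.Projective R A] [Module.Finite R A]
    (h : Function.Bijective (rightModuleComparison R A A))
    (M : Type u) [AddCommGroup M] [Module R M] [Module Aᵐᵒᵖ M] [IsScalarTower R Aᵐᵒᵖ M] :
    Function.Bijective (rightModuleComparison R A M) := by
  obtain ⟨n, p, s, -, -, hps⟩ := Module.Finite.exists_comp_eq_id_of_projective R A
  let x (i : Fin n) : A := p (Pi.single i 1)
  have hx (b : A) : ∑ i, s b i • x i = b := by
    conv_rhs => rw [← LinearMap.id_apply (R := R) b, ← hps, LinearMap.comp_apply,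
      pi_eq_sum_univ' (s b)]
    simp [x, map_sum]
  choose t ht using fun i ↦ h.2
    ((Algebra.linearMap R A) ∘ₗ (LinearMap.proj i) ∘ₗ s)
  let inv (N : Type u) [AddCommGroup N] [Module R N] [Module Aᵐᵒᵖ N] [IsScalarTower R Aᵐᵒᵖ N]
      (g : A →ₗ[R] N) : A ⊗[R] N := ∑ i, (rightOrbitMap R A (g (x i))).lTensor A (t i)
  have right_inv (N : Type u) [AddCommGroup N] [Module R N] [Module Aᵐᵒᵖ N]
      [IsScalarTower R Aᵐᵒᵖ N] (g : A →ₗ[R] N) : rightModuleComparison R A N (inv N g) = g := by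
    ext b
    conv_rhs => rw [← hx b]
    simp [inv, rightModuleComparison_lTensor_rightOrbitMap, ht, Algebra.algebraMap_eq_smul_one]
  have left_inv : Function.LeftInverse (inv M) (rightModuleComparison R A M) := by
    intro z
    induction z with
    | zero =>
      have : rightOrbitMap R A (0 : M) = 0 := by ext; simp
      simp [inv, this]
    | add y z hy hz =>
      have (m m' : M) : rightOrbitMap R A (m + m') = rightOrbitMap R A m + rightOrbitMap R A m' := by
        ext; simp
      conv_rhs => rw [← hy, ← hz]
      simp [inv, this, LinearMap.lTensor_add, Finset.sum_add_distrib]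
    | tmul a m =>
      have key : a ⊗ₜ m = (rightOrbitMap R A m).lTensor A (a ⊗ₜ[R] (1 : A)) := by simp
      have horb (y : A) : rightOrbitMap R A (rightOrbitMap R A m y) =
          rightOrbitMap R A m ∘ₗ rightOrbitMap R A y := by
        ext; simp [mul_smul]
      rw [key, rightModuleComparison_lTensor_rightOrbitMap]
      conv_rhs => rw [← h.1 (right_inv A (rightModuleComparison R A A (a ⊗ₜ 1)))]
      simp only [inv, map_sum, LinearMap.comp_apply, horb, LinearMap.lTensor_comp]
  exact ⟨left_inv.injective, fun g ↦ ⟨_, right_inv M g⟩⟩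

theorem unitIsPure_of_projective [Module.Projective R A] [Module.Finite R A] [FaithfulSMul R A] :
    UnitIsPure R A := by
  intro M _ _
  rw [injective_iff_map_eq_zero]
  intro z hz
  obtain ⟨m, rfl⟩ := (TensorProduct.lid R M).symm.surjective z
  simp only [TensorProduct.lid_symm_apply, LinearMap.rTensor_tmul, Algebra.linearMap_apply,
    map_one] at hz
  obtain ⟨n, p, s, -, -, hps⟩ := Module.Finite.exists_comp_eq_id_of_projective R A
  have hs (a : A) (i : Fin n) : s a i ∈ Ideal.torsionOf R M m := by
    have h1 : a ⊗ₜ[R] m = 0 := by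
      simpa using congr((LinearMap.mulLeft R a).rTensor M $hz)
    simpa using congr(TensorProduct.lid R M (((LinearMap.proj i) ∘ₗ s).rTensor M $h1))
  obtain ⟨r, hr, hr0⟩ := Submodule.exists_sub_one_mem_and_smul_eq_zero_of_fg_of_le_smul
    (Ideal.torsionOf R M m) (⊤ : Submodule R A) Module.Finite.fg_top (by
      intro b _
      rw [← LinearMap.id_apply (R := R) b, ← hps, LinearMap.comp_apply, pi_eq_sum_univ' (s b)]
      simp only [map_sum, map_smul]
      exact Submodule.sum_mem _ fun i _ ↦ Submodule.smul_mem_smul (hs b i) trivial)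
  obtain rfl : r = 0 := FaithfulSMul.eq_of_smul_eq_smul (α := A) fun a ↦ by
    rw [hr0 a trivial, zero_smul]
  have hm : m = 0 := by simpa using hr
  simp [hm]

lemma UnitIsPure.eq_zero_of_one_tmul_eq_zero (h : UnitIsPure R A) {M : Type u} [AddCommGroup M]
    [Module R M] {m : M} (hm : (1 : A) ⊗ₜ[R] m = 0) : m = 0 := by
  have h0 : (1 : R) ⊗ₜ[R] m = 0 := h M (by simpa using hm)
  simpa using congr(TensorProduct.lid R M $h0)

/-- A finite linear system over `R` that is solvable in `A` is solvable in `R`. -/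
lemma UnitIsPure.exists_mulVec_eq (h : UnitIsPure R A) {m n : ℕ} (B : Matrix (Fin m) (Fin n) R)
    (d : Fin m → R) (x : Fin n → A) (hx : ∀ k, ∑ j, B k j • x j = algebraMap R A (d k)) :
    ∃ y, B.mulVec y = d := by
  let q := (LinearMap.range B.mulVecLin).mkQ
  suffices q d = 0 by simpa [q] using this
  apply h.eq_zero_of_one_tmul_eq_zero
  have hq (j : Fin n) : ∑ k, B k j • q (Pi.single k 1) = 0 := by
    have hB : q (B.mulVecLin (Pi.single j 1)) = 0 := by
      rw [Submodule.mkQ_apply, Submodule.Quotient.mk_eq_zero]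
      exact LinearMap.mem_range_self _ _
    rw [pi_eq_sum_univ' (B.mulVecLin (Pi.single j 1))] at hB
    simpa [map_sum] using hB
  rw [pi_eq_sum_univ' d]
  calc (1 : A) ⊗ₜ[R] q (∑ k, d k • Pi.single k 1)
      = ∑ k, algebraMap R A (d k) ⊗ₜ q (Pi.single k 1) := by
        simp [map_sum, TensorProduct.tmul_sum, Algebra.algebraMap_eq_smul_one,
          TensorProduct.smul_tmul]
    _ = ∑ j, x j ⊗ₜ ∑ k, B k j • q (Pi.single k 1) := by
        simp only [← hx, TensorProduct.sum_tmul, TensorProduct.tmul_sum, TensorProduct.smul_tmul]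
        exact Finset.sum_comm
    _ = 0 := by simp [hq]

lemma UnitIsPure.exists_retraction (h : UnitIsPure R A) [Module.FinitePresentation R A] :
    ∃ ε : A →ₗ[R] R, ε 1 = 1 := by
  obtain ⟨n, p, hp⟩ := Module.Finite.exists_fin' R A
  obtain ⟨m, k, hk⟩ := Submodule.fg_iff_exists_fin_generating_family.mp
    (Module.FinitePresentation.fg_ker p hp)
  obtain ⟨c, hc⟩ := hp 1
  have hpx (v : Fin n → R) : ∑ j, v j • p (Pi.single j 1) = p v := by
    conv_rhs => rw [pi_eq_sum_univ' v]
    simp [map_sum]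
  obtain ⟨y, hy⟩ := h.exists_mulVec_eq (Matrix.of (Fin.cons c k)) (Fin.cons 1 0)
    (fun j ↦ p (Pi.single j 1)) (by
      refine Fin.cases ?_ fun i ↦ ?_
      · simp [hpx, hc]
      · have : k i ∈ LinearMap.ker p := hk ▸ Submodule.subset_span ⟨i, rfl⟩
        simpa [hpx] using this)
  let ψ : (Fin n → R) →ₗ[R] R := (dotProductBilin R R).flip y
  have hψ : LinearMap.ker p ≤ LinearMap.ker ψ := by
    rw [← hk, Submodule.span_le]
    rintro _ ⟨i, rfl⟩
    simpa [ψ, Matrix.mulVec] using congr_fun hy i.succ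
  refine ⟨(LinearMap.ker p).liftQ ψ hψ ∘ₗ (p.quotKerEquivOfSurjective hp).symm.toLinearMap, ?_⟩
  have : (p.quotKerEquivOfSurjective hp).symm 1 = Submodule.Quotient.mk c := by
    rw [LinearEquiv.symm_apply_eq, ← hc]; rfl
  simpa [this, ψ, Matrix.mulVec] using congr_fun hy 0

lemma rightModuleComparison_assoc_tmul (t : A ⊗[R] A) (x b : A) :
    rightModuleComparison R A (A ⊗[R] A) (TensorProduct.assoc R A A A (t ⊗ₜ x)) b =
      rightModuleComparison R A A t b ⊗ₜ x := by
  induction t with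
  | zero => simp
  | add s t hs ht => simp [TensorProduct.add_tmul, hs, ht]
  | tmul a m => simp [TensorProduct.smul_tmul']

/-- `A ⊗[R] A` has a finite dual basis over its left factor. -/
lemma exists_one_tmul_eq_sum
    (h : Function.Surjective (rightModuleComparison R A (A ⊗[R] A))) :
    ∃ (n : ℕ) (g : Fin n → Module.End R A) (x : Fin n → A),
      ∀ b : A, (1 : A) ⊗ₜ[R] b = ∑ i, g i b ⊗ₜ x i := by
  obtain ⟨t, ht⟩ := h (TensorProduct.mk R A A 1)
  obtain ⟨n, y, x, hyx⟩ := TensorProduct.exists_sum_tmul_eq ((TensorProduct.assoc R A A A).symm t)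
  refine ⟨n, fun i ↦ rightModuleComparison R A A (y i), x, fun b ↦ ?_⟩
  rw [← TensorProduct.mk_apply, ← ht, ← (TensorProduct.assoc R A A A).apply_symm_apply t, hyx]
  simp [rightModuleComparison_assoc_tmul]

lemma UnitIsPure.finitePresentation (h : UnitIsPure R A) {n : ℕ} (g : Fin n → Module.End R A)
    (x : Fin n → A) (hgx : ∀ b : A, (1 : A) ⊗ₜ[R] b = ∑ i, g i b ⊗ₜ x i) :
    Module.FinitePresentation R A := by
  let p : (Fin n → R) →ₗ[R] A := Fintype.linearCombination R x
  have hpx (i : Fin n) : p (Pi.single i 1) = x i := by simp [p]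
  have hp : Function.Surjective p := by
    rw [← LinearMap.range_eq_top, ← Submodule.ker_mkQ (LinearMap.range p), LinearMap.ker_eq_top]
    ext b
    apply h.eq_zero_of_one_tmul_eq_zero
    have hq (i : Fin n) : (LinearMap.range p).mkQ (x i) = 0 := by
      rw [← hpx, Submodule.mkQ_apply, Submodule.Quotient.mk_eq_zero]
      exact LinearMap.mem_range_self _ _
    simpa [-Submodule.mkQ_apply, hq] using congr((LinearMap.range p).mkQ.lTensor A $(hgx b))
  refine Module.finitePresentation_of_surjective p hp ?_
  let v (l : Fin n) : A ⊗[R] (Fin n → R) :=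
    1 ⊗ₜ Pi.single l 1 - ∑ i, g i (x l) ⊗ₜ Pi.single i 1
  have hv (l : Fin n) : ∃ w, (LinearMap.ker p).subtype.lTensor A w = v l := by
    refine (lTensor_exact A (LinearMap.exact_subtype_ker_map p) hp (v l)).mp ?_
    simp [v, hpx, hgx (x l)]
  choose w hw using hv
  obtain ⟨L, hfin, hwL⟩ := TensorProduct.exists_finite_submodule_right_of_setFinite
    (Set.range w) (Set.finite_range w)
  let K := L.map (LinearMap.ker p).subtype
  suffices LinearMap.ker p ≤ K from
    le_antisymm this (Submodule.map_subtype_le _ _) ▸ (Module.Finite.iff_fg.mp hfin).map _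
  have hvK (l : Fin n) : (1 : A) ⊗ₜ[R] K.mkQ (Pi.single l 1) =
      ∑ i, g i (x l) ⊗ₜ K.mkQ (Pi.single i 1) := by
    obtain ⟨z, hz⟩ := hwL ⟨l, rfl⟩
    have h0 : K.mkQ.lTensor A (v l) = 0 := by
      rw [← hw, ← hz, ← LinearMap.comp_apply, ← LinearMap.comp_apply, ← LinearMap.lTensor_comp,
        ← LinearMap.lTensor_comp]
      have : (K.mkQ ∘ₗ (LinearMap.ker p).subtype) ∘ₗ L.subtype = 0 := by
        ext y
        exact (Submodule.Quotient.mk_eq_zero K).mpr (Submodule.mem_map_of_mem y.2)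
      simp [this]
    rw [← sub_eq_zero]
    simpa [-Submodule.mkQ_apply, v] using h0
  have hlift : TensorProduct.mk R A _ 1 ∘ₗ K.mkQ =
      ∑ i, (TensorProduct.mk R A _).flip (K.mkQ (Pi.single i 1)) ∘ₗ g i ∘ₗ p := by
    refine (Pi.basisFun R (Fin n)).ext fun l ↦ ?_
    simpa [-Submodule.mkQ_apply, hpx] using hvK l
  intro k hk
  rw [← Submodule.ker_mkQ K, LinearMap.mem_ker]
  apply h.eq_zero_of_one_tmul_eq_zero
  simpa [-Submodule.mkQ_apply, LinearMap.mem_ker.mp hk] using congr($hlift k)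

lemma projective_of_retraction {ε : A →ₗ[R] R} (hε : ε 1 = 1) {n : ℕ}
    {g : Fin n → Module.End R A} {x : Fin n → A}
    (hgx : ∀ b : A, (1 : A) ⊗ₜ[R] b = ∑ i, g i b ⊗ₜ x i) : Module.Projective R A := by
  refine .of_split (LinearMap.pi fun i ↦ ε ∘ₗ g i) (Fintype.linearCombination R x) ?_
  ext b
  simpa [hε, Fintype.linearCombination_apply] using
    congr(TensorProduct.lid R A (ε.rTensor A $(hgx b))).symm

lemma UnitIsPure.faithfulSMul (h : UnitIsPure R A) : FaithfulSMul R A := by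
  rw [faithfulSMul_iff_algebraMap_injective, injective_iff_map_eq_zero]
  intro r hr
  apply h.eq_zero_of_one_tmul_eq_zero
  rw [← mul_one r, ← smul_eq_mul, ← TensorProduct.smul_tmul, ← Algebra.algebraMap_eq_smul_one, hr,
    TensorProduct.zero_tmul]

end AzumayaCriterion

theorem azumaya_iff_pure_and_rightModuleComparison_bijective
    (R A : Type u) [CommRing R] [Ring A] [Algebra R A] :
    IsAzumayaAlg R A ↔
      (UnitIsPure R A ∧
        ∀ (M : Type u) [AddCommGroup M] [Module R M] [Module Aᵐᵒᵖ M]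
          [IsScalarTower R Aᵐᵒᵖ M],
          Function.Bijective (rightModuleComparison R A M)) := by
  constructor
  · rintro ⟨_, _, _, hbij⟩
    exact ⟨unitIsPure_of_projective,
      rightModuleComparison_bijective_of_self (rightModuleComparison_self_bijective_iff.mpr hbij)⟩
  · rintro ⟨hpure, hbij⟩
    obtain ⟨n, g, x, hgx⟩ := exists_one_tmul_eq_sum (hbij (A ⊗[R] A)).surjective
    have := hpure.finitePresentation g x hgx
    obtain ⟨ε, hε⟩ := hpure.exists_retraction
    exact ⟨projective_of_retraction hε hgx, inferInstance, hpure.faithfulSMul,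
      rightModuleComparison_self_bijective_iff.mp (hbij A)⟩
end

section
/- Let R be a commutative ring and A an R-algebra. Then A is an Azumaya R-algebra if and only if the unit map R → A is a pure monomorphism of R-modules and for every (A,A)-bimodule M the evaluation map A ⊗_R M^A → M, a ⊗ m ↦ a·m, is bijective, where M^A = { m ∈ M | a·m = m·a for all a ∈ A } is the R-submodule of A-central elements. -/
/-!
STATEMENT 18: `A` is an Azumaya `R`-algebra iff the unit map `R → A` is a pure
monomorphism of `R`-modules and for every `(A,A)`-bimodule `M` (over `R`) the
evaluation map `A ⊗[R] M^A → M`, `a ⊗ m ↦ a • m`, is bijective, where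
`M^A = { m ∈ M | a•m = m•a for all a }` is the submodule of `A`-central elements.
-/

open TensorProduct

universe u

section Defs

variable (R A : Type u) [CommRing R] [Ring A] [Algebra R A]

variable (M : Type u) [AddCommGroup M] [Module R M]
  [Module A M] [Module Aᵐᵒᵖ M] [SMulCommClass A Aᵐᵒᵖ M]
  [IsScalarTower R A M] [IsScalarTower R Aᵐᵒᵖ M]

/-- The `R`-submodule `M^A` of `A`-central elements of an `(A,A)`-bimodule `M`. -/
def centralElements : Submodule R M where
  carrier := { m : M | ∀ a : A, a • m = MulOpposite.op a • m }
  add_mem' := by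
    intro x y hx hy a
    simp [smul_add, hx a, hy a]
  zero_mem' := by intro a; simp
  smul_mem' := by
    intro r m hm a
    rw [smul_comm, hm a, smul_comm]

/-- The evaluation map `A ⊗[R] M^A → M`, `a ⊗ m ↦ a • m`. -/
noncomputable def evaluationMap : A ⊗[R] (centralElements R A M) →ₗ[R] M :=
  TensorProduct.lift <| LinearMap.mk₂ R
    (fun a m => a • (m : M))
    (fun a₁ a₂ m => by simp [add_smul])
    (fun r a m => by simp [smul_assoc])
    (fun a m₁ m₂ => by simp [smul_add])
    (fun r a m => by simp [smul_comm r a])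

end Defs

namespace AzumayaEvaluation

variable {R A : Type u} [CommRing R] [Ring A] [Algebra R A]

theorem mulLeftRightMap_eq :
    mulLeftRightMap R A = (AlgHom.mulLeftRight R A).toLinearMap := by
  ext a b c
  simp [mulLeftRightMap]

/-- Elements of the enveloping algebra which are central for its outer bimodule structure. -/
def IsOuterCentral (e : A ⊗[R] Aᵐᵒᵖ) : Prop :=
  ∀ b : A, b ⊗ₜ[R] (1 : Aᵐᵒᵖ) * e = (1 : A) ⊗ₜ[R] MulOpposite.op b * e

theorem IsOuterCentral.mul_eq {e : A ⊗[R] Aᵐᵒᵖ} (he : IsOuterCentral e) (t : A ⊗[R] Aᵐᵒᵖ) :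
    t * e = (AlgHom.mulLeftRight R A t 1) ⊗ₜ[R] (1 : Aᵐᵒᵖ) * e := by
  induction t with
  | zero => simp
  | add x y hx hy => rw [add_mul, hx, hy, map_add, LinearMap.add_apply, TensorProduct.add_tmul,
      add_mul]
  | tmul u v =>
    have h : u ⊗ₜ[R] v = u ⊗ₜ[R] (1 : Aᵐᵒᵖ) * (1 : A) ⊗ₜ[R] MulOpposite.op v.unop := by simp
    rw [h, mul_assoc, ← he, ← mul_assoc]
    simp

theorem IsOuterCentral.mul_apply_comm {e : A ⊗[R] Aᵐᵒᵖ} (he : IsOuterCentral e) (b c : A) :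
    b * AlgHom.mulLeftRight R A e c = AlgHom.mulLeftRight R A e c * b := by
  have h := congrArg (fun t => AlgHom.mulLeftRight R A t c) (he b)
  simpa using h

theorem eq_sum_of_sum_eq_one {n : ℕ} {a : Fin n → A} {e : Fin n → A ⊗[R] Aᵐᵒᵖ}
    (he : ∀ i, IsOuterCentral (e i)) (h : ∑ i, a i ⊗ₜ[R] (1 : Aᵐᵒᵖ) * e i = 1)
    (t : A ⊗[R] Aᵐᵒᵖ) :
    t = ∑ i, (AlgHom.mulLeftRight R A t (a i)) ⊗ₜ[R] (1 : Aᵐᵒᵖ) * e i := by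
  calc t = t * ∑ i, a i ⊗ₜ[R] (1 : Aᵐᵒᵖ) * e i := by rw [h, mul_one]
    _ = _ := by
      rw [Finset.mul_sum]
      refine Finset.sum_congr rfl fun i _ => ?_
      rw [← mul_assoc, (he i).mul_eq]
      simp

/-- If every central element is a scalar and the unit of the enveloping algebra is generated by
outer-central elements, then the algebra is Azumaya. -/
theorem isAzumayaAlg_of_sum_eq_one (hinj : Function.Injective (algebraMap R A))
    (hcenter : ∀ z : A, (∀ b, b * z = z * b) → z ∈ LinearMap.range (Algebra.linearMap R A))
    {n : ℕ} {a : Fin n → A} {e : Fin n → A ⊗[R] Aᵐᵒᵖ}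
    (he : ∀ i, IsOuterCentral (e i)) (h : ∑ i, a i ⊗ₜ[R] (1 : Aᵐᵒᵖ) * e i = 1) :
    IsAzumayaAlg R A := by
  let j := LinearEquiv.ofInjective (Algebra.linearMap R A) hinj
  let f : A →ₗ[R] Fin n → R := LinearMap.pi fun i =>
    j.symm.toLinearMap ∘ₗ (AlgHom.mulLeftRight R A (e i)).codRestrict _
      fun c => hcenter _ fun b => (he i).mul_apply_comm b c
  have hf (c : A) (i : Fin n) : algebraMap R A (f c i) = AlgHom.mulLeftRight R A (e i) c :=
    congrArg Subtype.val (j.apply_symm_apply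
      ((AlgHom.mulLeftRight R A (e i)).codRestrict _
        (fun c => hcenter _ fun b => (he i).mul_apply_comm b c) c))
  have hsum (c : A) : ∑ i, f c i • a i = c := by
    have h1 := congrArg (fun t => AlgHom.mulLeftRight R A t c) h
    simpa [LinearMap.sum_apply, ← hf, Algebra.smul_def, Algebra.commutes] using h1
  let g : (Fin n → R) →ₗ[R] A := Fintype.linearCombination R a
  have hgf : g ∘ₗ f = LinearMap.id := by
    ext c
    simp [g, Fintype.linearCombination_apply, hsum]
  refine ⟨Module.Projective.of_split f g hgf,
    Module.Finite.of_surjective g fun c => ⟨f c, LinearMap.congr_fun hgf c⟩,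
    (faithfulSMul_iff_algebraMap_injective R A).2 hinj, ?_⟩
  rw [mulLeftRightMap_eq]
  refine ⟨(injective_iff_map_eq_zero _).2 fun t ht => ?_, fun φ =>
    ⟨∑ i, φ (a i) ⊗ₜ[R] (1 : Aᵐᵒᵖ) * e i, ?_⟩⟩
  · rw [eq_sum_of_sum_eq_one he h t]
    rw [AlgHom.toLinearMap_apply] at ht
    simp [ht]
  · ext c
    conv_rhs => rw [← hsum c, map_sum]
    simp only [map_smul]
    simp [LinearMap.sum_apply, ← hf, Algebra.smul_def, Algebra.commutes]

theorem exists_sum_eq_one (H : IsAzumayaAlg R A) :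
    ∃ (n : ℕ) (a : Fin n → A) (e : Fin n → A ⊗[R] Aᵐᵒᵖ) (f : Fin n → A →ₗ[R] R),
      (∀ i, IsOuterCentral (e i)) ∧ (∑ i, a i ⊗ₜ[R] (1 : Aᵐᵒᵖ) * e i = 1) ∧
      (∀ i c, AlgHom.mulLeftRight R A (e i) c = algebraMap R A (f i c)) ∧
      ∀ c, ∑ i, f i c • a i = c := by
  obtain ⟨_, _, _, hb⟩ := H
  rw [mulLeftRightMap_eq] at hb
  obtain ⟨n, g, f, -, -, hgf⟩ := Module.Finite.exists_comp_eq_id_of_projective R A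
  choose e he using fun i => hb.2 ((LinearMap.proj i ∘ₗ f).smulRight (1 : A))
  replace he (i : Fin n) (c : A) :
      AlgHom.mulLeftRight R A (e i) c = algebraMap R A (f c i) := by
    have := LinearMap.congr_fun (he i) c
    simpa [Algebra.algebraMap_eq_smul_one] using this
  have hsum (c : A) : ∑ i, f c i • g (Pi.single i 1) = c := by
    conv_rhs => rw [← LinearMap.id_apply (R := R) c, ← hgf, LinearMap.comp_apply,
      LinearMap.pi_apply_eq_sum_univ g (f c)]
    refine Finset.sum_congr rfl fun i _ => ?_
    congr 2
    ext k
    simp [Pi.single_apply, eq_comm]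
  refine ⟨n, fun i => g (Pi.single i 1), e, fun i => LinearMap.proj i ∘ₗ f, fun i b => ?_, ?_,
    fun i c => by simp [he], hsum⟩
  · apply hb.1
    ext c
    simp [he, Algebra.commutes]
  · apply hb.1
    ext c
    simp only [AlgHom.toLinearMap_apply, map_sum, map_mul, map_one, LinearMap.sum_apply,
      Module.End.mul_apply, he, AlgHom.mulLeftRight_apply, MulOpposite.unop_one, mul_one,
      Module.End.one_apply]
    conv_rhs => rw [← hsum c]
    simp [Algebra.smul_def, Algebra.commutes]

/-- A faithful finitely generated projective algebra has an `R`-linear retraction of its unit. -/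
theorem exists_retraction [Module.Projective R A] [Module.Finite R A] [FaithfulSMul R A] :
    ∃ h : A →ₗ[R] R, h 1 = 1 := by
  obtain ⟨n, g, f, -, -, hgf⟩ := Module.Finite.exists_comp_eq_id_of_projective R A
  let I : Ideal R := LinearMap.range (LinearMap.applyₗ (R := R) (M₂ := R) (1 : A))
  have hI (h : A →ₗ[R] R) (c : A) : h c ∈ I := ⟨h ∘ₗ LinearMap.mulRight R c, by simp⟩
  have hle : (⊤ : Submodule R A) ≤ I • ⊤ := by
    intro c _
    rw [← LinearMap.id_apply (R := R) c, ← hgf, LinearMap.comp_apply,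
      LinearMap.pi_apply_eq_sum_univ g (f c)]
    exact Submodule.sum_mem _ fun i _ =>
      Submodule.smul_mem_smul (hI (LinearMap.proj i ∘ₗ f) c) Submodule.mem_top
  obtain ⟨r, hr, hr0⟩ := Submodule.exists_sub_one_mem_and_smul_eq_zero_of_fg_of_le_smul I ⊤
    Module.Finite.fg_top hle
  have hr' : r = 0 := FaithfulSMul.eq_of_smul_eq_smul (α := A) fun c => by
    rw [hr0 c Submodule.mem_top, zero_smul]
  rw [hr', zero_sub] at hr
  exact (neg_mem_iff (S := Ideal R)).1 hr

theorem unitIsPure_of_retraction (h : A →ₗ[R] R) (h1 : h 1 = 1) : UnitIsPure R A := by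
  intro M _ _
  have hid : h ∘ₗ Algebra.linearMap R A = LinearMap.id := by
    ext
    simp [h1]
  refine Function.LeftInverse.injective (g := LinearMap.rTensor M h) fun x => ?_
  rw [← LinearMap.rTensor_comp_apply, hid, LinearMap.rTensor_id, LinearMap.id_apply]

theorem algebraMap_injective_of_unitIsPure (hp : UnitIsPure R A) :
    Function.Injective (algebraMap R A) := by
  intro x y hxy
  have := @hp R _ _ (x ⊗ₜ 1) (y ⊗ₜ 1) (by simp [hxy])
  simpa using congrArg (TensorProduct.lid R R) this

/-- Tensoring with an algebra whose unit is pure reflects surjectivity. -/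
theorem surjective_of_lTensor_of_unitIsPure (hp : UnitIsPure R A) {M N : Type u} [AddCommGroup M]
    [Module R M] [AddCommGroup N] [Module R N] (f : M →ₗ[R] N)
    (hf : Function.Surjective (f.lTensor A)) : Function.Surjective f := by
  have hzero (x : A ⊗[R] (N ⧸ LinearMap.range f)) : x = 0 := by
    obtain ⟨y, rfl⟩ := LinearMap.lTensor_surjective A (Submodule.mkQ_surjective _) x
    obtain ⟨z, rfl⟩ := hf y
    rw [← LinearMap.lTensor_comp_apply, LinearMap.range_mkQ_comp, LinearMap.lTensor_zero,
      LinearMap.zero_apply]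
  intro y
  rw [← LinearMap.mem_range, ← Submodule.Quotient.mk_eq_zero]
  have := @hp (N ⧸ LinearMap.range f) _ _ (1 ⊗ₜ Submodule.Quotient.mk y) 0
    ((hzero _).trans (hzero _).symm)
  simpa using congrArg (TensorProduct.lid R _) this

@[simp]
theorem evaluationMap_tmul (M : Type u) [AddCommGroup M] [Module R M]
    [Module A M] [Module Aᵐᵒᵖ M] [SMulCommClass A Aᵐᵒᵖ M]
    [IsScalarTower R A M] [IsScalarTower R Aᵐᵒᵖ M] (a : A) (m : centralElements R A M) :
    evaluationMap R A M (a ⊗ₜ m) = a • (m : M) := rfl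

theorem mem_range_of_commute (hp : UnitIsPure R A)
    (hinj : Function.Injective (evaluationMap R A A)) (z : A) (hz : ∀ b, b * z = z * b) :
    z ∈ LinearMap.range (Algebra.linearMap R A) := by
  let j : R →ₗ[R] centralElements R A A := (Algebra.linearMap R A).codRestrict _ fun r b => by
    simp [Algebra.commutes]
  have hj1 : (j 1 : A) = 1 := map_one (algebraMap R A)
  have hj : Function.Surjective j := by
    refine surjective_of_lTensor_of_unitIsPure hp j fun x => ⟨evaluationMap R A A x ⊗ₜ 1, hinj ?_⟩
    simp [hj1]
  obtain ⟨r, hr⟩ := hj ⟨z, fun b => by simpa using hz b⟩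
  exact ⟨r, congrArg Subtype.val hr⟩

theorem exists_sum_eq_one_of_algHom {E : Type u} [Ring E] [Algebra R E]
    (iA : A →ₐ[R] E) (iB : Aᵐᵒᵖ →ₐ[R] E) (hcomm : ∀ a b, Commute (iA a) (iB b))
    (H : ∀ (M : Type u) [AddCommGroup M] [Module R M] [Module A M] [Module Aᵐᵒᵖ M]
      [SMulCommClass A Aᵐᵒᵖ M] [IsScalarTower R A M] [IsScalarTower R Aᵐᵒᵖ M],
      Function.Surjective (evaluationMap R A M)) :
    ∃ (n : ℕ) (a : Fin n → A) (e : Fin n → E),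
      (∀ i b, iA b * e i = iB (MulOpposite.op b) * e i) ∧ ∑ i, iA (a i) * e i = 1 := by
  let _ : Module A E := Module.compHom E iA.toRingHom
  let _ : Module Aᵐᵒᵖ E := Module.compHom E iB.toRingHom
  have hA (a : A) (x : E) : a • x = iA a * x := rfl
  have hB (b : Aᵐᵒᵖ) (x : E) : b • x = iB b * x := rfl
  have : SMulCommClass A Aᵐᵒᵖ E := ⟨fun a b x => by
    rw [hA, hB, hB, hA, ← mul_assoc, ← mul_assoc, (hcomm a b).eq]⟩
  have : IsScalarTower R A E := ⟨fun r a x => by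
    rw [hA, hA, map_smul, smul_mul_assoc]⟩
  have : IsScalarTower R Aᵐᵒᵖ E := ⟨fun r a x => by
    rw [hB, hB, map_smul, smul_mul_assoc]⟩
  obtain ⟨t, ht⟩ := H E 1
  obtain ⟨n, a, e, rfl⟩ := TensorProduct.exists_sum_tmul_eq t
  refine ⟨n, a, fun i => (e i : E), fun i b => (e i).2 b, ?_⟩
  rw [map_sum] at ht
  exact ht

theorem evaluationMap_bijective (H : IsAzumayaAlg R A)
    (M : Type u) [AddCommGroup M] [Module R M] [Module A M] [Module Aᵐᵒᵖ M]
    [SMulCommClass A Aᵐᵒᵖ M] [IsScalarTower R A M] [IsScalarTower R Aᵐᵒᵖ M] :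
    Function.Bijective (evaluationMap R A M) := by
  obtain ⟨n, a, e, f, he, h1, hef, hsum⟩ := exists_sum_eq_one H
  let _ : Module (A ⊗[R] Aᵐᵒᵖ) M := TensorProduct.Algebra.module
  have hs (x : A) (y : Aᵐᵒᵖ) (m : M) : x ⊗ₜ[R] y • m = x • y • m :=
    TensorProduct.Algebra.smul_def x y m
  have hl (b : A) (m : M) : b • m = b ⊗ₜ[R] (1 : Aᵐᵒᵖ) • m := by rw [hs, one_smul]
  have hr (b : A) (m : M) : MulOpposite.op b • m = (1 : A) ⊗ₜ[R] MulOpposite.op b • m := by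
    rw [hs, one_smul]
  have hmem (i : Fin n) (m : M) : e i • m ∈ centralElements R A M := fun b => by
    rw [hl, hr, ← mul_smul, ← mul_smul, he i b]
  have hcentral (t : A ⊗[R] Aᵐᵒᵖ) (m : M) (hm : m ∈ centralElements R A M) :
      t • m = AlgHom.mulLeftRight R A t 1 • m := by
    induction t with
    | zero =>
      rw [map_zero, LinearMap.zero_apply]
      exact (zero_smul (A ⊗[R] Aᵐᵒᵖ) m).trans (zero_smul A m).symm
    | add x y hx hy => rw [add_smul, hx, hy, map_add, LinearMap.add_apply, add_smul]
    | tmul x y => rw [hs, ← MulOpposite.op_unop y, ← hm, ← mul_smul]; simp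
  have hsurj (m : M) :
      evaluationMap R A M (∑ i, a i ⊗ₜ ⟨e i • m, hmem i m⟩) = m := by
    simp only [map_sum, evaluationMap_tmul]
    simp_rw [hl, ← mul_smul]
    rw [← Finset.sum_smul, h1, one_smul]
  refine ⟨Function.LeftInverse.injective
    (g := fun m => ∑ i, a i ⊗ₜ ⟨e i • m, hmem i m⟩) fun x => ?_, fun m => ⟨_, hsurj m⟩⟩
  induction x with
  | zero =>
    refine Finset.sum_eq_zero fun i _ => ?_
    rw [← TensorProduct.tmul_zero _ (a i)]
    congr 1
    ext
    simp
  | add x y hx hy =>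
    dsimp only at hx hy ⊢
    conv_rhs => rw [← hx, ← hy, ← Finset.sum_add_distrib]
    refine Finset.sum_congr rfl fun i _ => ?_
    rw [← TensorProduct.tmul_add]
    congr 1
    ext
    simp
  | tmul c m =>
    conv_rhs => rw [← hsum c, TensorProduct.sum_tmul]
    refine Finset.sum_congr rfl fun i _ => ?_
    rw [TensorProduct.smul_tmul]
    congr 1
    apply Subtype.ext
    change e i • c • (m : M) = f i c • (m : M)
    rw [hl, ← mul_smul, hcentral _ _ m.2]
    simp [hef]

end AzumayaEvaluation

theorem azumaya_iff_pure_and_evaluation_bijective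
    (R A : Type u) [CommRing R] [Ring A] [Algebra R A] :
    IsAzumayaAlg R A ↔
      (UnitIsPure R A ∧
        ∀ (M : Type u) [AddCommGroup M] [Module R M] [Module A M] [Module Aᵐᵒᵖ M]
          [SMulCommClass A Aᵐᵒᵖ M] [IsScalarTower R A M] [IsScalarTower R Aᵐᵒᵖ M],
          Function.Bijective (evaluationMap R A M)) := by
  open AzumayaEvaluation in
  constructor
  · intro H
    obtain ⟨_, _, _, -⟩ := id H
    obtain ⟨h, h1⟩ := exists_retraction (R := R) (A := A)
    exact ⟨unitIsPure_of_retraction h h1, fun M => evaluationMap_bijective H M⟩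
  · rintro ⟨hp, H⟩
    obtain ⟨n, a, e, he, h1⟩ := exists_sum_eq_one_of_algHom
      (Algebra.TensorProduct.includeLeft : A →ₐ[R] A ⊗[R] Aᵐᵒᵖ)
      Algebra.TensorProduct.includeRight (fun a b => by simp [Commute, SemiconjBy])
      fun M => (H M).2
    exact isAzumayaAlg_of_sum_eq_one (algebraMap_injective_of_unitIsPure hp)
      (mem_range_of_commute hp (H A).1) he h1
end
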